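/- arXiv:1708.03354 — 2 statements merged into one kernel-verified Lean document; each statement's English description precedes it below -/
import Mathlib

section
/- Let r, s ≥ 0 be integers with w = r + s > 0 even. Then for every y > 0, the zeroth Fourier coefficient of the real analytic Eisenstein series satisfies ∫_0^1 𝓔_{r,s}(x + iy) dx = −(B_{w+2}/(2(w+1)(w+2)))·𝕃 + ((−1)^s/2)·(w!/2^w)·binom(w,r)·ζ(w+1)·𝕃^{−w}, where 𝕃 = −2πy, B_{w+2} is the (w+2)-nd Bernoulli number, and ζ is the Riemann zeta function. -/
open Complex

/-- `𝕃(z) = πi(z − z̄) = −2π·Im z`. -/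
noncomputable def Lfun (z : ℂ) : ℂ := (Real.pi : ℂ) * Complex.I * (z - (starRingEnd ℂ) z)

/-- The summand `(mz+n)^{−(r+1)}·(mz̄+n)^{−(s+1)}` of the real analytic Eisenstein series. -/
noncomputable def eisSummand (r s : ℕ) (z : ℂ) (p : ℤ × ℤ) : ℂ :=
  ((p.1 : ℂ) * z + (p.2 : ℂ)) ^ (-((r : ℤ) + 1)) *
    ((p.1 : ℂ) * (starRingEnd ℂ) z + (p.2 : ℂ)) ^ (-((s : ℤ) + 1))

/-- The real analytic Eisenstein series
`𝓔_{r,s}(z) = (w!/(2πi)^{w+2})·(1/2)·𝕃(z)·Σ'_{(m,n)} (mz+n)^{−(r+1)}(mz̄+n)^{−(s+1)}`. -/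
noncomputable def Eis (r s : ℕ) (z : ℂ) : ℂ :=
  ((r + s).factorial : ℂ) / (2 * (Real.pi : ℂ) * Complex.I) ^ (r + s + 2) * (1 / 2) *
    Lfun z * ∑' p : {p : ℤ × ℤ // p ≠ 0}, eisSummand r s z p.1

/-- The kernel `(t + i)^{-p} (t - i)^{-q}` on the real line. -/
noncomputable def cauchyKernel (p q : ℕ) (t : ℝ) : ℂ :=
  (((t : ℂ) + I) ^ p)⁻¹ * (((t : ℂ) - I) ^ q)⁻¹

lemma ofReal_add_I_ne_zero (t : ℝ) : (t : ℂ) + I ≠ 0 := fun h => by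
  simpa using congrArg Complex.im h

lemma ofReal_sub_I_ne_zero (t : ℝ) : (t : ℂ) - I ≠ 0 := fun h => by
  simpa using congrArg Complex.im h

lemma continuous_cauchyKernel (p q : ℕ) : Continuous (cauchyKernel p q) := by
  unfold cauchyKernel
  refine Continuous.mul (Continuous.inv₀ (by fun_prop) fun t => ?_)
    (Continuous.inv₀ (by fun_prop) fun t => ?_)
  · exact pow_ne_zero _ (ofReal_add_I_ne_zero t)
  · exact pow_ne_zero _ (ofReal_sub_I_ne_zero t)

lemma norm_ofReal_add_I (t : ℝ) : ‖(t : ℂ) + I‖ = √(1 + t ^ 2) := by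
  rw [Complex.norm_def, Complex.normSq_apply]
  congr 1
  simp
  ring

lemma norm_ofReal_sub_I (t : ℝ) : ‖(t : ℂ) - I‖ = √(1 + t ^ 2) := by
  rw [Complex.norm_def, Complex.normSq_apply]
  congr 1
  simp
  ring

lemma norm_cauchyKernel_le {p q : ℕ} (h : 2 ≤ p + q) (t : ℝ) :
    ‖cauchyKernel p q t‖ ≤ (1 + t ^ 2)⁻¹ := by
  have h1 : 1 ≤ √(1 + t ^ 2) := Real.one_le_sqrt.2 (by nlinarith [sq_nonneg t])
  rw [cauchyKernel, norm_mul, norm_inv, norm_inv, norm_pow, norm_pow, norm_ofReal_add_I,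
    norm_ofReal_sub_I, ← mul_inv, ← pow_add]
  refine inv_anti₀ (by positivity) ?_
  calc 1 + t ^ 2 = √(1 + t ^ 2) ^ 2 := (Real.sq_sqrt (by positivity)).symm
    _ ≤ _ := pow_le_pow_right₀ h1 h

lemma integrable_cauchyKernel {p q : ℕ} (h : 2 ≤ p + q) :
    MeasureTheory.Integrable (cauchyKernel p q) :=
  integrable_inv_one_add_sq.mono' (continuous_cauchyKernel p q).aestronglyMeasurable
    (Filter.Eventually.of_forall (norm_cauchyKernel_le h))

/-- A power of order at least two of a pole off the real line integrates to zero. -/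
lemma integral_inv_ofReal_add_pow {c : ℂ} (n : ℕ) (hc : ∀ t : ℝ, (t : ℂ) + c ≠ 0)
    (hi : MeasureTheory.Integrable fun t : ℝ => (((t : ℂ) + c) ^ (n + 2))⁻¹) :
    ∫ t : ℝ, (((t : ℂ) + c) ^ (n + 2))⁻¹ = 0 := by
  have hn : (n : ℂ) + 1 ≠ 0 := Nat.cast_add_one_ne_zero n
  have hd (t : ℝ) : HasDerivAt (fun t : ℝ => -((n : ℂ) + 1)⁻¹ * (((t : ℂ) + c) ^ (n + 1))⁻¹)
      (((t : ℂ) + c) ^ (n + 2))⁻¹ t := by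
    have h0 := (Complex.ofRealCLM.hasDerivAt (x := t)).add_const c
    have h1 := ((h0.pow (n + 1)).inv (pow_ne_zero _ (hc t))).const_mul (-((n : ℂ) + 1)⁻¹)
    refine h1.congr_deriv ?_
    have := hc t
    simp
    field_simp
    ring
  have ht (l : Filter ℝ) (hl : Filter.Tendsto (fun t : ℝ => ‖t‖) l Filter.atTop) :
      Filter.Tendsto (fun t : ℝ => -((n : ℂ) + 1)⁻¹ * (((t : ℂ) + c) ^ (n + 1))⁻¹) l (nhds 0) := by
    rw [← mul_zero (-((n : ℂ) + 1)⁻¹)]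
    refine Filter.Tendsto.const_mul _ ?_
    have h2 : Filter.Tendsto (fun t : ℝ => ‖(t : ℂ) + c‖) l Filter.atTop := by
      refine Filter.tendsto_atTop_mono (fun t => ?_)
        (Filter.tendsto_atTop_add_const_right l (-‖c‖) hl)
      have := norm_sub_le ((t : ℂ) + c) c
      simp only [add_sub_cancel_right, Complex.norm_real] at this
      linarith
    refine tendsto_zero_iff_norm_tendsto_zero.2 ?_
    simp only [norm_inv, norm_pow]
    exact ((Filter.tendsto_pow_atTop n.succ_ne_zero).comp h2).inv_tendsto_atTop
  simpa using MeasureTheory.integral_of_hasDerivAt_of_tendsto hd hi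
    (ht _ Filter.tendsto_abs_atBot_atTop) (ht _ Filter.tendsto_abs_atTop_atTop)

lemma integral_cauchyKernel_zero_left (n : ℕ) : ∫ t, cauchyKernel 0 (n + 2) t = 0 := by
  have hi := integrable_cauchyKernel (p := 0) (q := n + 2) (by omega)
  unfold cauchyKernel at hi ⊢
  simp only [pow_zero, inv_one, one_mul, sub_eq_add_neg] at hi ⊢
  exact integral_inv_ofReal_add_pow n
    (fun t => by simpa [sub_eq_add_neg] using ofReal_sub_I_ne_zero t) hi

lemma integral_cauchyKernel_zero_right (n : ℕ) : ∫ t, cauchyKernel (n + 2) 0 t = 0 := by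
  have hi := integrable_cauchyKernel (p := n + 2) (q := 0) (by omega)
  unfold cauchyKernel at hi ⊢
  simp only [pow_zero, inv_one, mul_one] at hi ⊢
  exact integral_inv_ofReal_add_pow n ofReal_add_I_ne_zero hi

lemma integral_cauchyKernel_one_one : ∫ t, cauchyKernel 1 1 t = Real.pi := by
  have h (t : ℝ) : cauchyKernel 1 1 t = (((1 + t ^ 2)⁻¹ : ℝ) : ℂ) := by
    rw [cauchyKernel, pow_one, pow_one, ← mul_inv]
    push_cast
    congr 1
    linear_combination -Complex.I_sq
  simp only [h]
  rw [integral_complex_ofReal, integral_univ_inv_one_add_sq]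

lemma cauchyKernel_succ_succ (p q : ℕ) (t : ℝ) :
    cauchyKernel (p + 1) (q + 1) t =
      (2 * I)⁻¹ * (cauchyKernel p (q + 1) t - cauchyKernel (p + 1) q t) := by
  have h1 := ofReal_add_I_ne_zero t
  have h2 := ofReal_sub_I_ne_zero t
  have h3 := Complex.I_ne_zero
  simp only [cauchyKernel]
  field_simp
  ring

lemma integral_cauchyKernel_succ_succ {p q : ℕ} (h : 1 ≤ p + q) :
    ∫ t, cauchyKernel (p + 1) (q + 1) t =
      (2 * I)⁻¹ * ((∫ t, cauchyKernel p (q + 1) t) - ∫ t, cauchyKernel (p + 1) q t) := by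
  simp only [cauchyKernel_succ_succ p q]
  rw [MeasureTheory.integral_const_mul, MeasureTheory.integral_sub
    (integrable_cauchyKernel (by omega)) (integrable_cauchyKernel (by omega))]

lemma integral_cauchyKernel (r s : ℕ) :
    ∫ t, cauchyKernel (r + 1) (s + 1) t =
      2 * Real.pi * I * (-1) ^ s * ((r + s).choose s : ℂ) / (2 * I) ^ (r + s + 1) := by
  have h3 := Complex.I_ne_zero
  induction h : r + s generalizing r s with
  | zero =>
    obtain ⟨rfl, rfl⟩ : r = 0 ∧ s = 0 := by omega
    rw [integral_cauchyKernel_one_one]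
    simp
    field_simp
  | succ n ih =>
    rw [integral_cauchyKernel_succ_succ (by omega)]
    rcases r with _ | r <;> rcases s with _ | s
    · omega
    · obtain rfl : s = n := by omega
      rw [integral_cauchyKernel_zero_left, ih 0 s (by omega)]
      simp only [Nat.choose_self]
      field_simp
      ring
    · obtain rfl : r = n := by omega
      rw [integral_cauchyKernel_zero_right, ih r 0 (by omega)]
      simp only [Nat.choose_zero_right]
      field_simp
      ring
    · rw [ih r (s + 1) (by omega), ih (r + 1) s (by omega), Nat.choose_succ_succ n s]
      push_cast
      field_simp
      ring

/-- Rescaled form of `integral_cauchyKernel`. -/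
lemma integral_scaled_cauchyKernel (r s : ℕ) {a : ℝ} (ha : 0 < a) :
    ∫ t : ℝ, (((a : ℂ) ^ (r + s + 2))⁻¹ * cauchyKernel (r + 1) (s + 1) (t / a)) =
      2 * Real.pi * I * (-1) ^ s * ((r + s).choose s : ℂ) / (2 * I * a) ^ (r + s + 1) := by
  have ha' : (a : ℂ) ≠ 0 := by exact_mod_cast ha.ne'
  rw [MeasureTheory.integral_const_mul,
    MeasureTheory.Measure.integral_comp_div (fun t => cauchyKernel (r + 1) (s + 1) t) a,
    integral_cauchyKernel, abs_of_pos ha, Complex.real_smul, mul_pow (2 * I), mul_pow 2 I]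
  have := Complex.I_ne_zero
  field_simp
  ring

/-- Averaging `f (m x + n)` over `x ∈ [0, 1]` and summing over `n` gives `∫ f`. -/
lemma hasSum_integral_mul_add_int {f : ℝ → ℂ} (hf : MeasureTheory.Integrable f)
    (hc : Continuous f) {m : ℕ} (hm : m ≠ 0) :
    HasSum (fun n : ℤ => ∫ x in (0 : ℝ)..1, f (m * x + n)) (∫ t, f t) := by
  have hm' : (m : ℝ) ≠ 0 := by exact_mod_cast hm
  have hmc : (m : ℂ) ≠ 0 := by exact_mod_cast hm
  have h := (hasSum_sum (s := Finset.range m) fun (j : ℕ) _ =>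
    hf.hasSum_intervalIntegral (j : ℝ)).mul_left (m : ℂ)⁻¹
  rw [Finset.sum_const, Finset.card_range, nsmul_eq_mul, inv_mul_cancel_left₀ hmc] at h
  refine h.congr_fun fun n => ?_
  rw [intervalIntegral.integral_comp_mul_add _ hm']
  have h2 := intervalIntegral.sum_integral_adjacent_intervals (f := f)
    (μ := MeasureTheory.volume) (a := fun j : ℕ => (j : ℝ) + n) (n := m)
    (fun k _ => hc.intervalIntegrable _ _)
  simp only [Nat.cast_add, Nat.cast_one, add_right_comm _ (1 : ℝ), Nat.cast_zero] at h2
  rw [h2, Complex.real_smul]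
  simp

lemma hasSum_int_natAbs_pow_inv {k : ℕ} (hk : 2 ≤ k) :
    HasSum (fun m : ℤ => ((m.natAbs : ℂ) ^ k)⁻¹) (2 * riemannZeta k) := by
  have hs : Summable fun n : ℕ => ((n : ℂ) ^ k)⁻¹ :=
    (Summable.of_norm (by simpa using (by omega : 1 < k)))
  have h := hs.hasSum
  have hz := zeta_nat_eq_tsum_of_gt_one (k := k) (by omega)
  simp only [one_div] at hz
  rw [← hz] at h
  have := HasSum.of_nat_of_neg (f := fun m : ℤ => ((m.natAbs : ℂ) ^ k)⁻¹)
    (g := riemannZeta k) (g' := riemannZeta k) (by simpa using h) (by simpa using h)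
  have h0 : k ≠ 0 := by omega
  simpa [h0, two_mul] using this

lemma eisSummand_eq_inv (r s : ℕ) (z : ℂ) (p : ℤ × ℤ) :
    eisSummand r s z p = (((p.1 : ℂ) * z + p.2) ^ (r + 1))⁻¹ *
      (((p.1 : ℂ) * (starRingEnd ℂ) z + p.2) ^ (s + 1))⁻¹ := by
  rw [eisSummand, zpow_neg, zpow_neg]
  norm_cast

lemma eisSummand_neg {r s : ℕ} (h : Even (r + s)) (z : ℂ) (p : ℤ × ℤ) :
    eisSummand r s z (-p) = eisSummand r s z p := by
  simp only [eisSummand_eq_inv, Prod.fst_neg, Prod.snd_neg, Int.cast_neg, neg_mul, ← neg_add]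
  rw [neg_pow _ (r + 1), neg_pow _ (s + 1), mul_inv, mul_inv, mul_mul_mul_comm, ← mul_inv,
    ← pow_add, Even.neg_one_pow (by grind)]
  simp

lemma norm_eisSummand (r s : ℕ) (z : ℂ) (p : ℤ × ℤ) :
    ‖eisSummand r s z p‖ = ‖(p.1 : ℂ) * z + p.2‖ ^ (-((r + s + 2 : ℕ) : ℝ)) := by
  have h : (p.1 : ℂ) * (starRingEnd ℂ) z + p.2 = (starRingEnd ℂ) ((p.1 : ℂ) * z + p.2) := by simp
  rw [eisSummand_eq_inv, h, norm_mul, norm_inv, norm_inv, norm_pow, norm_pow, Complex.norm_conj,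
    Real.rpow_neg (norm_nonneg _), Real.rpow_natCast, ← mul_inv, ← pow_add]
  congr 2
  ring

lemma eisSummand_zero_left {r s : ℕ} (h : Even (r + s)) (z : ℂ) (n : ℤ) :
    eisSummand r s z (0, n) = ((n.natAbs : ℂ) ^ (r + s + 2))⁻¹ := by
  have h2 : Even (r + s + 2) := by grind
  have h3 : ((n.natAbs : ℂ)) ^ (r + s + 2) = (n : ℂ) ^ (r + s + 2) := by
    have : ((n.natAbs : ℤ)) ^ (r + s + 2) = n ^ (r + s + 2) := by
      rw [Int.natCast_natAbs, h2.pow_abs]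
    simpa using congrArg (Int.cast : ℤ → ℂ) this
  rw [h3, eisSummand_eq_inv]
  simp only [Int.cast_zero, zero_mul, zero_add]
  rw [← mul_inv, ← pow_add]
  congr 2
  ring

lemma eisSummand_natCast_left (r s : ℕ) {m : ℕ} (hm : m ≠ 0) {y : ℝ} (hy : 0 < y) (x : ℝ) (n : ℤ) :
    eisSummand r s (x + y * I) ((m : ℤ), n) = ((((m * y : ℝ) : ℂ) ^ (r + s + 2))⁻¹ *
      cauchyKernel (r + 1) (s + 1) ((m * x + n) / (m * y))) := by
  have hm' : (m : ℂ) ≠ 0 := by exact_mod_cast hm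
  have hy' : (y : ℂ) ≠ 0 := by exact_mod_cast hy.ne'
  have h1 : (((m : ℤ) : ℂ) * ((x : ℂ) + y * I) + n) =
      (m * y) * ((((m * x + n) / (m * y) : ℝ) : ℂ) + I) := by
    push_cast
    field_simp
    ring
  have h2 : (((m : ℤ) : ℂ) * (starRingEnd ℂ) ((x : ℂ) + y * I) + n) =
      (m * y) * ((((m * x + n) / (m * y) : ℝ) : ℂ) - I) := by
    simp only [map_add, map_mul, Complex.conj_ofReal, Complex.conj_I]
    push_cast
    field_simp
    ring
  rw [eisSummand_eq_inv, h1, h2, cauchyKernel, mul_pow _ _ (r + 1), mul_pow _ _ (s + 1), mul_inv,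
    mul_inv, mul_mul_mul_comm, ← mul_inv, ← pow_add]
  push_cast
  congr 3
  ring

lemma hasSum_integral_eisSummand_natCast_left (r s : ℕ) {m : ℕ} (hm : m ≠ 0) {y : ℝ} (hy : 0 < y) :
    HasSum (fun n : ℤ => ∫ x in (0 : ℝ)..1, eisSummand r s (x + y * I) ((m : ℤ), n))
      (2 * Real.pi * I * (-1) ^ s * ((r + s).choose s : ℂ) / (2 * I * y) ^ (r + s + 1) *
        ((m : ℂ) ^ (r + s + 1))⁻¹) := by
  have hmy : 0 < m * y := by positivity
  have h := hasSum_integral_mul_add_int (m := m)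
    (((integrable_cauchyKernel (p := r + 1) (q := s + 1) (by omega)).comp_div hmy.ne').const_mul
      (((m * y : ℝ) : ℂ) ^ (r + s + 2))⁻¹)
    (continuous_const.mul ((continuous_cauchyKernel _ _).comp (continuous_id.div_const _))) hm
  rw [integral_scaled_cauchyKernel r s hmy] at h
  simp only [← eisSummand_natCast_left r s hm hy] at h
  convert h using 1
  push_cast
  rw [mul_left_comm, mul_pow (m : ℂ), div_mul_eq_div_div_swap, div_eq_mul_inv _ ((m : ℂ) ^ _)]

lemma hasSum_integral_eisSummand_left {r s : ℕ} (h : Even (r + s)) {m : ℤ} (hm : m ≠ 0) {y : ℝ}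
    (hy : 0 < y) :
    HasSum (fun n : ℤ => ∫ x in (0 : ℝ)..1, eisSummand r s (x + y * I) (m, n))
      (2 * Real.pi * I * (-1) ^ s * ((r + s).choose s : ℂ) / (2 * I * y) ^ (r + s + 1) *
        ((m.natAbs : ℂ) ^ (r + s + 1))⁻¹) := by
  have h1 := hasSum_integral_eisSummand_natCast_left r s (Int.natAbs_ne_zero.2 hm) hy
  rcases Int.natAbs_eq m with h2 | h2
  · rwa [← h2] at h1
  · rw [← (Equiv.neg ℤ).hasSum_iff]
    convert h1 using 1
    ext n
    refine intervalIntegral.integral_congr fun x _ => ?_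
    change eisSummand r s _ (m, -n) = _
    rw [← eisSummand_neg h]
    simp only [Prod.neg_mk, neg_neg]
    rw [show -m = (m.natAbs : ℤ) by omega]

lemma continuous_eisSummand (r s : ℕ) {y : ℝ} (hy : 0 < y) (p : ℤ × ℤ) :
    Continuous fun x : ℝ => eisSummand r s (x + y * I) p := by
  by_cases hp : p.1 = 0
  · simp only [eisSummand, hp, Int.cast_zero, zero_mul]
    exact continuous_const
  have hne (x : ℝ) : (p.1 : ℂ) * (x + y * I) + p.2 ≠ 0 := fun h => by
    have := congrArg Complex.im h
    simp [hp, hy.ne'] at this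
  have hne' (x : ℝ) : (p.1 : ℂ) * (starRingEnd ℂ) (x + y * I) + p.2 ≠ 0 := fun h => by
    have := congrArg Complex.im h
    simp [hp, hy.ne'] at this
  simp only [eisSummand_eq_inv]
  have hconj : Continuous (starRingEnd ℂ) := Complex.continuous_conj
  exact (Continuous.inv₀ (by fun_prop) fun x => pow_ne_zero _ (hne x)).mul
    (Continuous.inv₀ (by fun_prop) fun x => pow_ne_zero _ (hne' x))

/-- A summable majorant of `‖m z + n‖ ^ (-k)`, uniform for `re z` in `[0, 1]`. -/
lemma exists_summable_norm_rpow_neg_le {k : ℝ} (hk : 2 < k) {y : ℝ} (hy : 0 < y) :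
    ∃ u : ℤ × ℤ → ℝ, Summable u ∧ ∀ p : ℤ × ℤ, ∀ x ∈ Set.Icc (0 : ℝ) 1,
      ‖(p.1 : ℂ) * ((x : ℂ) + y * I) + p.2‖ ^ (-k) ≤ u p := by
  have hs := ((finTwoArrowEquiv ℤ).symm.summable_iff.2
    (EisensteinSeries.summable_one_div_norm_rpow hk)).mul_left
      (EisensteinSeries.r ⟨⟨1, y⟩, hy⟩ ^ (-k))
  refine ⟨_, hs, fun p x hx => ?_⟩
  have hz : 0 < ((x : ℂ) + y * I).im := by simpa using hy
  have hmem : (⟨(x : ℂ) + y * I, hz⟩ : UpperHalfPlane) ∈ UpperHalfPlane.verticalStrip 1 y := by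
    have h1 : |x| ≤ 1 := abs_le.2 ⟨by linarith [hx.1], hx.2⟩
    rw [UpperHalfPlane.mem_verticalStrip_iff]
    exact ⟨by simpa [UpperHalfPlane.re] using h1, by simp [UpperHalfPlane.im]⟩
  have h := EisensteinSeries.summand_bound_of_mem_verticalStrip (k := k) (by linarith)
    ((finTwoArrowEquiv ℤ).symm p) hy hmem
  simpa only [finTwoArrowEquiv_symm_apply, Matrix.cons_val_zero, Matrix.cons_val_one,
    Function.comp_apply] using h

lemma exists_summable_norm_eisSummand_le {r s : ℕ} (h : 0 < r + s) {y : ℝ} (hy : 0 < y) :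
    ∃ u : ℤ × ℤ → ℝ, Summable u ∧
      ∀ p, ∀ x ∈ Set.Icc (0 : ℝ) 1, ‖eisSummand r s (x + y * I) p‖ ≤ u p := by
  simp only [norm_eisSummand]
  exact exists_summable_norm_rpow_neg_le (by exact_mod_cast (by omega)) hy

lemma hasSum_integral_eisSummand {r s : ℕ} (h : 0 < r + s) {y : ℝ} (hy : 0 < y) :
    HasSum (fun p : ℤ × ℤ => ∫ x in (0 : ℝ)..1, eisSummand r s (x + y * I) p)
      (∫ x in (0 : ℝ)..1, ∑' p : ℤ × ℤ, eisSummand r s (x + y * I) p) := by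
  obtain ⟨u, hu, hle⟩ := exists_summable_norm_eisSummand_le h hy
  have hle' (p : ℤ × ℤ) (x : ℝ) (hx : x ∈ Set.uIoc (0 : ℝ) 1) :
      ‖eisSummand r s (x + y * I) p‖ ≤ u p := by
    rw [Set.uIoc_of_le zero_le_one] at hx
    exact hle p x (Set.Ioc_subset_Icc_self hx)
  refine intervalIntegral.hasSum_integral_of_dominated_convergence (fun p _ => u p)
    (fun p => (continuous_eisSummand r s hy p).aestronglyMeasurable)
    (fun p => Filter.Eventually.of_forall (hle' p))
    (Filter.Eventually.of_forall fun x _ => hu) (by simp)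
    (Filter.Eventually.of_forall fun x hx =>
      (Summable.of_norm_bounded hu fun p => hle' p x hx).hasSum)

lemma tsum_eisSummand_ne_zero (r s : ℕ) (z : ℂ) :
    ∑' p : {p : ℤ × ℤ // p ≠ 0}, eisSummand r s z p.1 = ∑' p : ℤ × ℤ, eisSummand r s z p := by
  refine tsum_subtype_eq_of_support_subset (s := {p : ℤ × ℤ | p ≠ 0}) fun p hp => ?_
  rintro rfl
  simp [eisSummand_eq_inv] at hp

lemma integral_tsum_eisSummand {r s : ℕ} (h : 0 < r + s) (he : Even (r + s)) {y : ℝ} (hy : 0 < y) :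
    (∫ x in (0 : ℝ)..1, ∑' p : ℤ × ℤ, eisSummand r s (x + y * I) p) =
      2 * riemannZeta (r + s + 2 : ℕ) +
        2 * Real.pi * I * (-1) ^ s * ((r + s).choose s : ℂ) / (2 * I * y) ^ (r + s + 1) *
          (2 * riemannZeta (r + s + 1 : ℕ)) := by
  have h1 := hasSum_ite_eq (0 : ℤ) (2 * riemannZeta (r + s + 2 : ℕ))
  have h2 := (hasSum_int_natAbs_pow_inv (k := r + s + 1) (by omega)).mul_left
    (2 * Real.pi * I * (-1) ^ s * ((r + s).choose s : ℂ) / (2 * I * y) ^ (r + s + 1))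
  refine ((hasSum_integral_eisSummand h hy).prod_fiberwise fun m => ?_).unique (h1.add h2)
  rcases eq_or_ne m 0 with rfl | hm
  · simpa [eisSummand_zero_left he] using hasSum_int_natAbs_pow_inv (k := r + s + 2) (by omega)
  · simpa [hm] using hasSum_integral_eisSummand_left he hm hy

lemma two_pi_I_pow_inv_mul_riemannZeta {k : ℕ} (hk : k ≠ 0) (he : Even k) :
    (k.factorial : ℂ) / (2 * Real.pi * I) ^ k * riemannZeta k = -(bernoulli k : ℂ) / 2 := by
  obtain ⟨j, rfl⟩ := even_iff_exists_two_mul.1 he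
  have hf : ((2 * j).factorial : ℂ) ≠ 0 := by exact_mod_cast (2 * j).factorial_ne_zero
  have hp : (Real.pi : ℂ) ≠ 0 := by exact_mod_cast Real.pi_ne_zero
  have h2 : (2 : ℂ) ^ (2 * j) = 2 ^ (2 * j - 1) * 2 := by
    rw [← pow_succ]
    congr 1
    omega
  rw [Nat.cast_mul, Nat.cast_ofNat, riemannZeta_two_mul_nat (by omega), mul_pow, mul_pow, h2,
    pow_mul I, Complex.I_sq, pow_succ]
  have h1 : ((-1 : ℂ) ^ j) ≠ 0 := by simp
  field_simp

lemma Lfun_add_mul_I (x y : ℝ) : Lfun (x + y * I) = (((-2 : ℝ) * Real.pi * y : ℝ) : ℂ) := by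
  simp only [Lfun, map_add, map_mul, Complex.conj_ofReal, Complex.conj_I]
  push_cast
  linear_combination (2 * Real.pi * y : ℂ) * Complex.I_sq

/-- The zeroth Fourier coefficient (constant part) of the real analytic Eisenstein series:
`∫_0^1 𝓔_{r,s}(x+iy) dx = −(B_{w+2}/(2(w+1)(w+2)))·𝕃 + ((−1)^s/2)·(w!/2^w)·C(w,r)·ζ(w+1)·𝕃^{−w}`
with `𝕃 = −2πy`. -/
theorem eis_constant_part (r s w : ℕ) (hrs : r + s = w) (hw : 0 < w) (he : Even w)
    (y : ℝ) (hy : 0 < y) :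
    (∫ x in (0 : ℝ)..1, Eis r s ((x : ℂ) + (y : ℂ) * Complex.I))
      = -((bernoulli (w + 2) : ℂ) / (2 * ((w : ℂ) + 1) * ((w : ℂ) + 2)))
          * (((-2 : ℝ) * Real.pi * y : ℝ) : ℂ)
        + ((-1 : ℂ) ^ s / 2) * ((w.factorial : ℂ) / 2 ^ w) * (w.choose r : ℂ)
          * riemannZeta ((w : ℂ) + 1)
          * (((-2 : ℝ) * Real.pi * y : ℝ) : ℂ) ^ (-(w : ℤ)) := by
  subst hrs
  simp only [Eis, Lfun_add_mul_I, tsum_eisSummand_ne_zero]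
  rw [intervalIntegral.integral_const_mul, integral_tsum_eisSummand hw he hy]
  have hb := two_pi_I_pow_inv_mul_riemannZeta (k := r + s + 2) (by omega) (by grind)
  have hp : (Real.pi : ℂ) ≠ 0 := by exact_mod_cast Real.pi_ne_zero
  have hy' : (y : ℂ) ≠ 0 := by exact_mod_cast hy.ne'
  have hI := Complex.I_ne_zero
  have hc : (r + s).choose r = (r + s).choose s := Nat.choose_symm_add
  have hf : ((r + s + 2).factorial : ℂ) =
      (((r + s : ℕ) : ℂ) + 2) * (((r + s : ℕ) : ℂ) + 1) * ((r + s).factorial : ℂ) := by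
    rw [Nat.factorial_succ, Nat.factorial_succ]
    push_cast
    ring
  have h1 : ((r + s : ℕ) : ℂ) + 1 ≠ 0 := Nat.cast_add_one_ne_zero _
  have h2 : ((r + s : ℕ) : ℂ) + 2 ≠ 0 := by exact_mod_cast (r + s + 1).succ_ne_zero
  rw [hf] at hb
  have hz : riemannZeta ((r + s + 1 : ℕ) : ℂ) = riemannZeta (((r + s : ℕ) : ℂ) + 1) := by
    push_cast
    rfl
  set L : ℂ := (((-2 : ℝ) * Real.pi * y : ℝ) : ℂ) with hL
  have hL' : L = -2 * Real.pi * y := by rw [hL]; push_cast; rfl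
  have hL0 : L ≠ 0 := by rw [hL']; simp [hp, hy']
  have h3 : (2 * Real.pi * I) ^ (r + s + 1) * (2 * I * y) ^ (r + s + 1) = (2 * L) ^ (r + s + 1) := by
    rw [← mul_pow, hL']
    congr 1
    linear_combination (4 * Real.pi * y : ℂ) * Complex.I_sq
  rw [mul_add, hz, hc, zpow_neg, zpow_natCast]
  congr 1
  · generalize riemannZeta ((r + s + 2 : ℕ) : ℂ) = Z at hb ⊢
    generalize ((r + s : ℕ) : ℂ) = W at *
    field_simp at hb ⊢
    linear_combination hb
  · have hA : (2 * (Real.pi : ℂ) * I) ^ (r + s + 1) ≠ 0 := by simp [hp]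
    have hB : (2 * I * (y : ℂ)) ^ (r + s + 1) ≠ 0 := by simp [hy']
    rw [pow_succ _ (r + s + 1)]
    generalize riemannZeta (((r + s : ℕ) : ℂ) + 1) = Z
    calc _ = ((r + s).factorial : ℂ) * L * (-1) ^ s * ((r + s).choose s : ℂ) * Z /
          ((2 * Real.pi * I) ^ (r + s + 1) * (2 * I * y) ^ (r + s + 1)) := by
          field_simp
      _ = _ := by
          rw [h3, mul_pow, pow_succ, pow_succ]
          field_simp
end

section
/- Let n ≥ 0 and let f_{r,s}, A_{r,s}, B_{r,s} : ℍ → ℂ be twice continuously differentiable functions for r,s ≥ 0 with r+s = 2n, extended by zero to negative indices (in particular f_{2n+1,−1} = f_{−1,2n+1} = 0 and B_{2n+1,−1} = 0). Assume the two systems: ∂_r f_{r,s} − (r+1)·f_{r+1,s−1} = 𝕃·A_{r,s} and ∂̄_s f_{r,s} − (s+1)·f_{r−1,s+1} = 𝕃·B_{r,s} for all r+s = 2n. Then for all r,s ≥ 0 with r+s = 2n the inhomogeneous Laplace equation holds: Δ_{r,s} f_{r,s} + 2n·f_{r,s} = −𝕃·(∂̄_s A_{r,s} + (r+1)·B_{r+1,s−1}),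 where Δ_{r,s} = −∂̄_{s−1}∘∂_r + r(s−1). -/
open Complex

/-- The holomorphic Wirtinger derivative `∂/∂z = ½(∂/∂x − i ∂/∂y)`. -/
noncomputable def wderiv (f : ℂ → ℂ) (z : ℂ) : ℂ :=
  (1 / 2) * (fderiv ℝ f z 1 - Complex.I * fderiv ℝ f z Complex.I)

/-- The anti-holomorphic Wirtinger derivative `∂/∂z̄ = ½(∂/∂x + i ∂/∂y)`. -/
noncomputable def wderivBar (f : ℂ → ℂ) (z : ℂ) : ℂ :=
  (1 / 2) * (fderiv ℝ f z 1 + Complex.I * fderiv ℝ f z Complex.I)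

/-- The Maass-type raising operator `(∂_r f)(z) = (z − z̄)·(∂f/∂z)(z) + r·f(z)`. -/
noncomputable def dOp (r : ℤ) (f : ℂ → ℂ) (z : ℂ) : ℂ :=
  (z - (starRingEnd ℂ) z) * wderiv f z + (r : ℂ) * f z

/-- The Maass-type lowering operator `(∂̄_s f)(z) = (z̄ − z)·(∂f/∂z̄)(z) + s·f(z)`. -/
noncomputable def dBarOp (s : ℤ) (f : ℂ → ℂ) (z : ℂ) : ℂ :=
  ((starRingEnd ℂ) z - z) * wderivBar f z + (s : ℂ) * f z

theorem Filter.EventuallyEq.dBarOp_eq {f g : ℂ → ℂ} {z : ℂ} (h : f =ᶠ[nhds z] g) (s : ℤ) :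
    dBarOp s f z = dBarOp s g z := by
  simp only [dBarOp, wderivBar, h.fderiv_eq, h.eq_of_nhds]

theorem dBarOp_add {f g : ℂ → ℂ} {z : ℂ} (hf : DifferentiableAt ℝ f z)
    (hg : DifferentiableAt ℝ g z) (s : ℤ) :
    dBarOp s (fun w => f w + g w) z = dBarOp s f z + dBarOp s g z := by
  simp only [dBarOp, wderivBar, fderiv_fun_add hf hg, add_apply]
  ring

theorem dBarOp_const_mul {f : ℂ → ℂ} {z : ℂ} (hf : DifferentiableAt ℝ f z) (c : ℂ) (s : ℤ) :
    dBarOp s (fun w => c * f w) z = c * dBarOp s f z := by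
  simp only [dBarOp, wderivBar, fderiv_const_mul hf c, smul_apply,
    smul_eq_mul]
  ring

theorem hasFDerivAt_Lfun (z : ℂ) :
    HasFDerivAt Lfun (((Real.pi : ℂ) * Complex.I) •
      (ContinuousLinearMap.id ℝ ℂ - (Complex.conjCLE : ℂ →L[ℝ] ℂ))) z :=
  ((hasFDerivAt_id z).sub Complex.conjCLE.hasFDerivAt).const_mul _

/-- Multiplication by `𝕃` shifts the weight of the lowering operator by one. -/
theorem dBarOp_Lfun_mul {f : ℂ → ℂ} {z : ℂ} (hf : DifferentiableAt ℝ f z) (s : ℤ) :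
    dBarOp (s - 1) (fun w => Lfun w * f w) z = Lfun z * dBarOp s f z := by
  have h := ((hasFDerivAt_Lfun z).mul hf.hasFDerivAt).fderiv
  simp only [dBarOp, wderivBar]
  rw [show (fun w => Lfun w * f w) = Lfun * f from rfl, h]
  simp [Lfun]
  linear_combination ((starRingEnd ℂ) z - z) * (Real.pi : ℂ) * Complex.I * f z * Complex.I_sq

/-- Given the two systems `∂_r f_{r,s} − (r+1) f_{r+1,s−1} = 𝕃·A_{r,s}` and
`∂̄_s f_{r,s} − (s+1) f_{r−1,s+1} = 𝕃·B_{r,s}` (indices extended by zero), each component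
satisfies the inhomogeneous Laplace equation
`Δ_{r,s} f_{r,s} + 2n f_{r,s} = −𝕃(∂̄_s A_{r,s} + (r+1) B_{r+1,s−1})` where
`Δ_{r,s} = −∂̄_{s−1}∘∂_r + r(s−1)`.  The index `r` runs over `0,…,2n` and `s = 2n−r`. -/
theorem inhomogeneous_laplace_equation (n : ℕ) (f A B : ℕ → ℂ → ℂ)
    (hf : ∀ r ≤ 2 * n, ContDiffOn ℝ 2 (f r) {z : ℂ | 0 < z.im})
    (hA : ∀ r ≤ 2 * n, ContDiffOn ℝ 2 (A r) {z : ℂ | 0 < z.im})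
    (hB : ∀ r ≤ 2 * n, ContDiffOn ℝ 2 (B r) {z : ℂ | 0 < z.im})
    (h1 : ∀ r ≤ 2 * n, ∀ z : ℂ, 0 < z.im →
      dOp (r : ℤ) (f r) z - ((r : ℂ) + 1) * (if r + 1 ≤ 2 * n then f (r + 1) z else 0)
        = Lfun z * A r z)
    (h2 : ∀ r ≤ 2 * n, ∀ z : ℂ, 0 < z.im →
      dBarOp ((2 * n - r : ℕ) : ℤ) (f r) z
          - (((2 * n - r : ℕ) : ℂ) + 1) * (if 1 ≤ r then f (r - 1) z else 0)
        = Lfun z * B r z) :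
    ∀ r ≤ 2 * n, ∀ z : ℂ, 0 < z.im →
      (-(dBarOp (((2 * n - r : ℕ) : ℤ) - 1) (dOp (r : ℤ) (f r)) z)
          + ((r : ℂ) * (((2 * n - r : ℕ) : ℂ) - 1)) * f r z)
        + ((2 * n : ℕ) : ℂ) * f r z
      = -(Lfun z) * (dBarOp ((2 * n - r : ℕ) : ℤ) (A r) z
          + ((r : ℂ) + 1) * (if r + 1 ≤ 2 * n then B (r + 1) z else 0)) := by
  intro r hr z hz
  have hU : {z : ℂ | 0 < z.im} ∈ nhds z :=
    (isOpen_lt continuous_const Complex.continuous_im).mem_nhds hz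
  have hdiff : ∀ {g : ℂ → ℂ}, ContDiffOn ℝ 2 g {z : ℂ | 0 < z.im} → DifferentiableAt ℝ g z :=
    fun hg => (hg.contDiffAt hU).differentiableAt (by norm_num)
  have hAr := hdiff (hA r hr)
  have hLA : DifferentiableAt ℝ (fun w => Lfun w * A r w) z :=
    (hasFDerivAt_Lfun z).differentiableAt.mul hAr
  by_cases hr' : r + 1 ≤ 2 * n
  · have hfr := hdiff (hf (r + 1) hr')
    have key : dOp (r : ℤ) (f r) =ᶠ[nhds z]
        fun w => ((r : ℂ) + 1) * f (r + 1) w + Lfun w * A r w := by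
      filter_upwards [hU] with w hw
      have := h1 r hr w hw
      rw [if_pos hr'] at this
      linear_combination this
    have hlow := h2 (r + 1) hr' z hz
    have hs : ((2 * n - (r + 1) : ℕ) : ℤ) = ((2 * n - r : ℕ) : ℤ) - 1 := by omega
    have hs' : ((2 * n - (r + 1) : ℕ) : ℂ) = ((2 * n - r : ℕ) : ℂ) - 1 := by
      exact_mod_cast congrArg (Int.cast : ℤ → ℂ) hs
    rw [hs, hs', if_pos (Nat.le_add_left 1 r), Nat.add_sub_cancel] at hlow
    rw [key.dBarOp_eq, dBarOp_add (hfr.const_mul _) hLA, dBarOp_const_mul hfr,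
      dBarOp_Lfun_mul hAr, if_pos hr']
    have hn : ((2 * n : ℕ) : ℂ) = r + ((2 * n - r : ℕ) : ℂ) := by
      exact_mod_cast (Nat.add_sub_of_le hr).symm
    rw [hn]
    linear_combination -((r : ℂ) + 1) * hlow
  · obtain rfl : r = 2 * n := by omega
    have key : dOp ((2 * n : ℕ) : ℤ) (f (2 * n)) =ᶠ[nhds z]
        fun w => Lfun w * A (2 * n) w := by
      filter_upwards [hU] with w hw
      have := h1 _ hr w hw
      rw [if_neg hr'] at this
      linear_combination this
    rw [key.dBarOp_eq, dBarOp_Lfun_mul hAr, if_neg hr', Nat.sub_self]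
    push_cast
    ring
end
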